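/- arXiv:2210.00499 — 2 statements merged into one kernel-verified Lean document; each statement's English description precedes it below -/
import Mathlib

section
/- Let (λ_n)_{n≥1} be a strictly increasing sequence of positive real numbers such that c·n² ≤ λ_n ≤ M·n² for all n ≥ 1, with constants 0 < c ≤ M, and let α ∈ (3/4, 1). Then there exist sequences (a_k) and (ξ_k) of real numbers with a_k > ξ_k > 0 such that each open interval (a_k − ξ_k, a_k + ξ_k) contains no term of the sequence (λ_n), ξ_k → ∞ as k → ∞, and a_k^{α/2}/ξ_k → 0 as k → ∞. -/
open Filter Real

/-- Among `N` consecutive increments of a real sequence, one is at least the average. -/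
theorem exists_average_le_increment (u : ℕ → ℝ) (m N : ℕ) (hN : 0 < N) :
    ∃ i < N, (u (m + N) - u m) / N ≤ u (m + i + 1) - u (m + i) := by
  have hsum : ∑ _i ∈ Finset.range N, (u (m + N) - u m) / N
      ≤ ∑ i ∈ Finset.range N, (u (m + i + 1) - u (m + i)) := by
    have h := Finset.sum_range_sub (fun i => u (m + i)) N
    simp only [← add_assoc, add_zero] at h
    have hN' : (N : ℝ) ≠ 0 := by positivity
    rw [h, Finset.sum_const, Finset.card_range, nsmul_eq_mul, mul_div_cancel₀ _ hN']
  obtain ⟨i, hi, h⟩ :=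
    Finset.exists_le_of_sum_le (Finset.nonempty_range_iff.mpr hN.ne') hsum
  exact ⟨i, Finset.mem_range.mp hi, h⟩

/-- A sequence with two-sided quadratic bounds has, at every scale `m`, a gap of length at least
of order `m` located at height at most of order `m ^ 2`. -/
theorem exists_linear_gap_of_quadratic_bounds (u : ℕ → ℝ) (c M : ℝ) (hc : 0 < c) (hcM : c ≤ M)
    (hbound : ∀ n : ℕ, 1 ≤ n → c * (n : ℝ) ^ 2 ≤ u n ∧ u n ≤ M * (n : ℝ) ^ 2) :
    ∃ B D : ℝ, 0 < B ∧ 0 < D ∧ ∀ m : ℕ, 1 ≤ m →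
      ∃ j : ℕ, 1 ≤ j ∧ D * m ≤ u (j + 1) - u j ∧ u (j + 1) ≤ B * (m : ℝ) ^ 2 := by
  have hM : 0 < M := hc.trans_le hcM
  obtain ⟨K, hK⟩ := exists_nat_ge (M / c)
  have hK0 : (0 : ℝ) < K := (div_pos hM hc).trans_le hK
  have hKM : M ≤ K * c := (div_le_iff₀ hc).mp hK
  refine ⟨M * (1 + K) ^ 2, c / K, by positivity, by positivity, fun m hm => ?_⟩
  have hm0 : (0 : ℝ) < m := by exact_mod_cast hm
  have hN : 0 < K * m := Nat.mul_pos (by exact_mod_cast hK0) hm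
  obtain ⟨i, hi, h⟩ := exists_average_le_increment u m (K * m) hN
  refine ⟨m + i, by omega, le_trans ?_ h, ?_⟩
  · have h1 := (hbound (m + K * m) (by omega)).1
    have h2 := (hbound m hm).2
    push_cast at h1 ⊢
    rw [le_div_iff₀ (by positivity)]
    have e : c / K * m * (K * m) = c * (m : ℝ) ^ 2 := by field_simp
    rw [e]
    have h3 : M * (m : ℝ) ^ 2 ≤ K * c * (m : ℝ) ^ 2 := by gcongr
    have h4 : 0 ≤ c * (K : ℝ) ^ 2 * (m : ℝ) ^ 2 := by positivity
    have h5 : 0 ≤ K * c * (m : ℝ) ^ 2 := by positivity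
    linarith
  · refine (hbound (m + i + 1) (by omega)).2.trans ?_
    have h1 : ((m + i + 1 : ℕ) : ℝ) ≤ (1 + K) * m := by
      have : m + i + 1 ≤ (1 + K) * m := by rw [add_mul, one_mul]; omega
      exact_mod_cast this
    rw [mul_assoc, ← mul_pow]
    gcongr

/-- Spectral-gap verification in Theorem 4.1: if the strictly increasing positive
sequence `(lam n)_{n≥1}` satisfies `c n² ≤ lam n ≤ M n²` and `α ∈ (3/4, 1)`, then there
are gaps `(a_k - ξ_k, a_k + ξ_k)` free of the `lam n` with `ξ_k → ∞` and
`a_k^{α/2} = o(ξ_k)`. -/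
theorem stmt4 (lam : ℕ → ℝ) (c M : ℝ) (hc : 0 < c) (hcM : c ≤ M)
    (hpos : ∀ n : ℕ, 1 ≤ n → 0 < lam n)
    (hmono : ∀ n : ℕ, 1 ≤ n → lam n < lam (n + 1))
    (hbound : ∀ n : ℕ, 1 ≤ n → c * (n : ℝ) ^ 2 ≤ lam n ∧ lam n ≤ M * (n : ℝ) ^ 2)
    (α : ℝ) (hα : 3 / 4 < α ∧ α < 1) :
    ∃ a ξ : ℕ → ℝ,
      (∀ k, 0 < ξ k ∧ ξ k < a k) ∧
      (∀ k, ∀ n : ℕ, 1 ≤ n → lam n ∉ Set.Ioo (a k - ξ k) (a k + ξ k)) ∧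
      Filter.Tendsto ξ Filter.atTop Filter.atTop ∧
      Filter.Tendsto (fun k => a k ^ (α / 2) / ξ k) Filter.atTop (nhds 0) := by
  have hle : ∀ {p q : ℕ}, 1 ≤ p → p ≤ q → lam p ≤ lam q := by
    intro p q hp hpq
    induction q, hpq using Nat.le_induction with
    | base => exact le_rfl
    | succ n hn ih => exact ih.trans (hmono n (hp.trans hn)).le
  obtain ⟨B, D, hB, hD, hgap⟩ := exists_linear_gap_of_quadratic_bounds lam c M hc hcM hbound
  choose j hj hjD hjB using fun k : ℕ => hgap (k + 1) (Nat.succ_pos k)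
  have hcast : Tendsto (fun k : ℕ => ((k + 1 : ℕ) : ℝ)) atTop atTop :=
    tendsto_natCast_atTop_atTop.comp (tendsto_add_atTop_nat 1)
  have hξ : ∀ k, D / 2 * ((k + 1 : ℕ) : ℝ) ≤ (lam (j k + 1) - lam (j k)) / 2 := fun k => by
    linarith [hjD k]
  refine ⟨fun k => (lam (j k + 1) + lam (j k)) / 2, fun k => (lam (j k + 1) - lam (j k)) / 2,
    fun k => ⟨?_, ?_⟩, ?_, ?_, ?_⟩
  · linarith [hmono _ (hj k)]
  · linarith [hpos _ (hj k)]
  · rintro k n hn ⟨h1, h2⟩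
    rcases le_or_gt n (j k) with h | h
    · linarith [hle hn h]
    · linarith [hle (Nat.succ_pos (j k)) h]
  · exact tendsto_atTop_mono hξ (hcast.const_mul_atTop (by positivity))
  · have hlim : Tendsto (fun k : ℕ => B ^ (α / 2) / (D / 2) * ((k + 1 : ℕ) : ℝ) ^ (-(1 - α)))
        atTop (nhds 0) := by
      simpa using ((tendsto_rpow_neg_atTop (sub_pos.mpr hα.2)).comp hcast).const_mul
        (B ^ (α / 2) / (D / 2))
    refine squeeze_zero (fun k => ?_) (fun k => ?_) hlim
    · have := hmono _ (hj k)
      have := hpos _ (hj k)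
      exact div_nonneg (rpow_nonneg (by linarith) _) (by linarith)
    · have hlt := hmono _ (hj k)
      have hp := hpos _ (hj k)
      have hm : (0 : ℝ) < ((k + 1 : ℕ) : ℝ) := by positivity
      have hα0 : 0 ≤ α / 2 := by linarith [hα.1]
      calc ((lam (j k + 1) + lam (j k)) / 2) ^ (α / 2) / ((lam (j k + 1) - lam (j k)) / 2)
          ≤ (B * ((k + 1 : ℕ) : ℝ) ^ 2) ^ (α / 2) / (D / 2 * ((k + 1 : ℕ) : ℝ)) := by
            refine div_le_div₀ (by positivity) (rpow_le_rpow (by linarith) ?_ hα0)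
              (by positivity) (hξ k)
            linarith [hjB k]
        _ = B ^ (α / 2) / (D / 2) * ((k + 1 : ℕ) : ℝ) ^ (-(1 - α)) := by
            rw [mul_rpow hB.le (by positivity), ← rpow_natCast_mul hm.le, neg_sub,
              rpow_sub_one hm.ne', Nat.cast_ofNat, mul_div_cancel₀ α two_ne_zero]
            exact mul_div_mul_comm _ _ _ _
end

section
/- Let D be an invertible real m×m matrix, let B₀ : ℝ → M_m(ℝ) be continuous, let B : ℝ → M_m(ℝ) be continuously differentiable, let U : ℝ → M_m(ℝ) be differentiable with U'(x) = −(1/2)·D^{-1}·B(x)·U(x) for all x, and let η : ℝ → ℝ^m be twice differentiable. Set h(x) = U(x)·η(x). Then for every x: D·h''(x) + B₀(x)·h(x) + B(x)·h'(x) = (B₀(x) − (1/2)·B'(x) − (1/4)·B(x)·D^{-1}·B(x))·h(x) + D·U(x)·η''(x). -/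
open Matrix

/-- The product rule for a matrix-valued function, differentiated entrywise, acting on a
vector-valued function. -/
theorem Matrix.hasDerivAt_mulVec {m n : Type*} [Fintype m] [Fintype n]
    {A : ℝ → Matrix m n ℝ} {A' : Matrix m n ℝ} {v : ℝ → n → ℝ} {v' : n → ℝ} {x : ℝ}
    (hA : ∀ i j, HasDerivAt (fun t => A t i j) (A' i j) x) (hv : HasDerivAt v v' x) :
    HasDerivAt (fun t => (A t).mulVec (v t)) (A'.mulVec (v x) + (A x).mulVec v') x := by
  rw [hasDerivAt_pi] at hv ⊢
  intro i
  simp only [mulVec, dotProduct, Pi.add_apply, ← Finset.sum_add_distrib]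
  exact HasDerivAt.fun_sum fun j _ => (hA i j).mul (hv j)

/-- Change-of-variables computation of Section 3 (Kamaev's substitution `h = U η`):
if `U' = -(1/2) D⁻¹ B(x) U`, then
`D h'' + B₀(x) h + B(x) h' = (B₀ - (1/2) B' - (1/4) B D⁻¹ B) h + D U η''`. -/
theorem stmt10 (m : ℕ) (D : Matrix (Fin m) (Fin m) ℝ) (hD : IsUnit D)
    (B₀ B B' : ℝ → Matrix (Fin m) (Fin m) ℝ)
    (hB₀ : Continuous B₀)
    (hBdiff : ∀ (x : ℝ) (i j : Fin m), HasDerivAt (fun t => B t i j) (B' x i j) x)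
    (hB'cont : Continuous B')
    (U : ℝ → Matrix (Fin m) (Fin m) ℝ)
    (hU : ∀ (x : ℝ) (i j : Fin m),
      HasDerivAt (fun t => U t i j) ((-(1 / 2 : ℝ) • (D⁻¹ * B x * U x)) i j) x)
    (η η' η'' : ℝ → Fin m → ℝ)
    (hη : ∀ x : ℝ, HasDerivAt η (η' x) x)
    (hη' : ∀ x : ℝ, HasDerivAt η' (η'' x) x)
    (h h' h'' : ℝ → Fin m → ℝ)
    (hh : ∀ x : ℝ, h x = (U x).mulVec (η x))
    (hh' : ∀ x : ℝ, HasDerivAt h (h' x) x)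
    (hh'' : ∀ x : ℝ, HasDerivAt h' (h'' x) x) :
    ∀ x : ℝ,
      D.mulVec (h'' x) + (B₀ x).mulVec (h x) + (B x).mulVec (h' x)
        = (B₀ x - (1 / 2 : ℝ) • B' x - (1 / 4 : ℝ) • (B x * D⁻¹ * B x)).mulVec (h x)
          + (D * U x).mulVec (η'' x) := by
  have hdet : IsUnit D.det := (isUnit_iff_isUnit_det D).mp hD
  have first (x : ℝ) : h' x = -(1 / 2 : ℝ) • D⁻¹.mulVec ((B x).mulVec (h x))
      + (U x).mulVec (η' x) := by
    have H := hasDerivAt_mulVec (hU x) (hη x)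
    rw [← funext hh] at H
    rw [(hh' x).unique H, hh]
    simp only [smul_mulVec, mulVec_mulVec, Matrix.mul_assoc]
  intro x
  have second : h'' x = -(1 / 2 : ℝ) • D⁻¹.mulVec ((B' x).mulVec (h x) + (B x).mulVec (h' x))
      + (-(1 / 2 : ℝ) • D⁻¹.mulVec ((B x).mulVec ((U x).mulVec (η' x)))
        + (U x).mulVec (η'' x)) := by
    have hDinv (i j : Fin m) : HasDerivAt (fun _ : ℝ => D⁻¹ i j)
        ((0 : Matrix (Fin m) (Fin m) ℝ) i j) x := hasDerivAt_const x _
    have H := ((hasDerivAt_mulVec hDinv (hasDerivAt_mulVec (hBdiff x) (hh' x))).const_smul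
      (-(1 / 2 : ℝ))).add (hasDerivAt_mulVec (hU x) (hη' x))
    have H' := (hh'' x).unique (H.congr_of_eventuallyEq (.of_forall first))
    simpa only [zero_mulVec, Matrix.zero_mul, zero_add, smul_mulVec, mulVec_mulVec,
      Matrix.mul_assoc] using H'
  have cancel (v : Fin m → ℝ) : D.mulVec (D⁻¹.mulVec v) = v := by
    rw [mulVec_mulVec, mul_nonsing_inv D hdet, one_mulVec]
  rw [second]
  simp only [mulVec_add, mulVec_smul, cancel, sub_mulVec, smul_mulVec, ← mulVec_mulVec]
  rw [first x]
  simp only [mulVec_add, mulVec_smul]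
  module
end
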